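/- (Theorem 1(a), second direction) For all formulas F, G, the sequent (SI1): ∃y(∀x(F↔x=y)∧G[y/x]) ⇒ Ix[F,G], where y is a variable not occurring in F or G, is provable in GPFL=^I. -/

import Mathlib

/-!
Deep embedding of the language of classical positive free logic with the
binary quantifier `I` for definite descriptions (`Ix[F,G]`, "the F is G"),
and of Indrzejczak's sequent calculus GPFL= extended by the rules for `I`
(the system GPFL=^I of Kürbis).  Bound variables are de Bruijn indices,
free variables are "parameters" (natural numbers).
-/

/-- A first-order signature: function symbols and predicate symbols with arities. -/
structure Sig where
  Fn : Type
  fnAr : Fn → ℕ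
  Pr : Type
  prAr : Pr → ℕ

/-- Terms: parameters, constants, (de Bruijn) bound variables and function terms. -/
inductive Tm (σ : Sig) : Type
  | par : ℕ → Tm σ
  | const : ℕ → Tm σ
  | bvar : ℕ → Tm σ
  | func : (f : σ.Fn) → (Fin (σ.fnAr f) → Tm σ) → Tm σ

namespace Tm

variable {σ : Sig}

/-- Lift (shift up by one) the bound variables `≥ c`. -/
def lift (c : ℕ) : Tm σ → Tm σ
  | par a => par a
  | const k => const k
  | bvar n => if n < c then bvar n else bvar (n + 1)
  | func f ts => func f fun i => (ts i).lift c

/-- Substitute the term `u` for the bound variable `k`. -/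
def inst (k : ℕ) (u : Tm σ) : Tm σ → Tm σ
  | par a => par a
  | const c => const c
  | bvar n => if n = k then u else if k < n then bvar (n - 1) else bvar n
  | func f ts => func f fun i => inst k u (ts i)

/-- Substitute the term `u` for the parameter `a`. -/
def substPar (a : ℕ) (u : Tm σ) : Tm σ → Tm σ
  | par b => if b = a then u else par b
  | const c => const c
  | bvar n => bvar n
  | func f ts => func f fun i => substPar a u (ts i)

/-- The set of parameters occurring in a term. -/
def pars : Tm σ → Set ℕ
  | par a => {a}
  | const _ => ∅
  | bvar _ => ∅
  | func _ ts => ⋃ i, (ts i).pars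

/-- A term is `ClosedB` if it contains no (dangling) bound variables; genuine
terms of the language are of this kind, and such a term is automatically
free for any variable in any formula. -/
def ClosedB : Tm σ → Prop
  | par _ => True
  | const _ => True
  | bvar _ => False
  | func _ ts => ∀ i, (ts i).ClosedB

end Tm

/-- Formulas, including the existence predicate `ext t` (`∃!t`) and the binary
quantifier `iq F G` (`Ix[F,G]`), which binds the de Bruijn variable `0` in
both `F` and `G`. -/
inductive Fml (σ : Sig) : Type
  | atom : (p : σ.Pr) → (Fin (σ.prAr p) → Tm σ) → Fml σ
  | eq : Tm σ → Tm σ → Fml σ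
  | ext : Tm σ → Fml σ
  | neg : Fml σ → Fml σ
  | conj : Fml σ → Fml σ → Fml σ
  | disj : Fml σ → Fml σ → Fml σ
  | imp : Fml σ → Fml σ → Fml σ
  | all : Fml σ → Fml σ
  | ex : Fml σ → Fml σ
  | iq : Fml σ → Fml σ → Fml σ

namespace Fml

variable {σ : Sig}

/-- Lift (shift up by one) the bound variables `≥ c`. -/
def lift (c : ℕ) : Fml σ → Fml σ
  | atom p ts => atom p fun i => (ts i).lift c
  | eq t s => eq (t.lift c) (s.lift c)
  | ext t => ext (t.lift c)
  | neg A => neg (A.lift c)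
  | conj A B => conj (A.lift c) (B.lift c)
  | disj A B => disj (A.lift c) (B.lift c)
  | imp A B => imp (A.lift c) (B.lift c)
  | all A => all (A.lift (c + 1))
  | ex A => ex (A.lift (c + 1))
  | iq F G => iq (F.lift (c + 1)) (G.lift (c + 1))

/-- Substitute the term `u` for the bound variable `k`. -/
def inst (k : ℕ) (u : Tm σ) : Fml σ → Fml σ
  | atom p ts => atom p fun i => Tm.inst k u (ts i)
  | eq t s => eq (Tm.inst k u t) (Tm.inst k u s)
  | ext t => ext (Tm.inst k u t)
  | neg A => neg (A.inst k u)
  | conj A B => conj (A.inst k u) (B.inst k u)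
  | disj A B => disj (A.inst k u) (B.inst k u)
  | imp A B => imp (A.inst k u) (B.inst k u)
  | all A => all (A.inst (k + 1) (u.lift 0))
  | ex A => ex (A.inst (k + 1) (u.lift 0))
  | iq F G => iq (F.inst (k + 1) (u.lift 0)) (G.inst (k + 1) (u.lift 0))

/-- `A.inst0 t` is `A[t/x]`: the result of substituting `t` for the
outermost bound variable `x` (de Bruijn index 0) of `A`. -/
def inst0 (A : Fml σ) (u : Tm σ) : Fml σ := A.inst 0 u

/-- Substitute the term `u` for the parameter `a`. -/
def substPar (a : ℕ) (u : Tm σ) : Fml σ → Fml σ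
  | atom p ts => atom p fun i => Tm.substPar a u (ts i)
  | eq t s => eq (Tm.substPar a u t) (Tm.substPar a u s)
  | ext t => ext (Tm.substPar a u t)
  | neg A => neg (A.substPar a u)
  | conj A B => conj (A.substPar a u) (B.substPar a u)
  | disj A B => disj (A.substPar a u) (B.substPar a u)
  | imp A B => imp (A.substPar a u) (B.substPar a u)
  | all A => all (A.substPar a u)
  | ex A => ex (A.substPar a u)
  | iq F G => iq (F.substPar a u) (G.substPar a u)

/-- The set of parameters occurring in a formula. -/
def pars : Fml σ → Set ℕ
  | atom _ ts => ⋃ i, (ts i).pars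
  | eq t s => t.pars ∪ s.pars
  | ext t => t.pars
  | neg A => A.pars
  | conj A B => A.pars ∪ B.pars
  | disj A B => A.pars ∪ B.pars
  | imp A B => A.pars ∪ B.pars
  | all A => A.pars
  | ex A => A.pars
  | iq F G => F.pars ∪ G.pars

/-- The degree of a formula: the number of logical operators occurring in it;
`∃!t` counts as atomic (degree 0). -/
def deg : Fml σ → ℕ
  | atom _ _ => 0
  | eq _ _ => 0
  | ext _ => 0
  | neg A => A.deg + 1
  | conj A B => A.deg + B.deg + 1
  | disj A B => A.deg + B.deg + 1
  | imp A B => A.deg + B.deg + 1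
  | all A => A.deg + 1
  | ex A => A.deg + 1
  | iq F G => F.deg + G.deg + 1

/-- Atomic formulas: predications, identities and existence statements. -/
def Atomic : Fml σ → Prop
  | atom _ _ => True
  | eq _ _ => True
  | ext _ => True
  | _ => False

/-- `A ↔ B` abbreviates `(A → B) ∧ (B → A)`. -/
def iff (A B : Fml σ) : Fml σ := conj (imp A B) (imp B A)

/-- The formula `∃!x` (with `x` the variable bound by the surrounding
binder), used as the second argument of `I` in `Ix[F, ∃!x]`. -/
def exG : Fml σ := ext (Tm.bvar 0)

end Fml

/-- The parameter `a` does not occur in any formula of `Γ`. -/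
def FreshM {σ : Sig} (a : ℕ) (Γ : Multiset (Fml σ)) : Prop := ∀ B ∈ Γ, a ∉ B.pars

/-- Proof trees of the sequent calculus GPFL=^I: Indrzejczak's calculus GPFL=
for classical positive free logic with identity, extended by Kürbis' rules
(RI), (LI¹), (LI²), (LI³), (LI⁴), (LI⁵) for the binary quantifier `I`.
Sequents relate finite multisets of formulas.  The parameter `P` constrains
the cut formulas: every cut formula of the proof must satisfy `P`
(so `P := fun _ => True` puts no constraint, and `P := fun _ => False` means
cut-free).  The last index is the height of the proof tree: the number of
nodes of its longest branch. -/
inductive Prf (σ : Sig) (P : Fml σ → Prop) :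
    Multiset (Fml σ) → Multiset (Fml σ) → ℕ → Type
  | ax (A : Fml σ) : Prf σ P {A} {A} 1
  | cut {Γ Θ Δ Λ : Multiset (Fml σ)} {m n : ℕ} (A : Fml σ) :
      Prf σ P Γ (A ::ₘ Θ) m → Prf σ P (A ::ₘ Δ) Λ n → P A →
      Prf σ P (Γ + Δ) (Θ + Λ) (max m n + 1)
  | lw {Γ Δ : Multiset (Fml σ)} {n : ℕ} (A : Fml σ) :
      Prf σ P Γ Δ n → Prf σ P (A ::ₘ Γ) Δ (n + 1)
  | rw {Γ Δ : Multiset (Fml σ)} {n : ℕ} (A : Fml σ) :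
      Prf σ P Γ Δ n → Prf σ P Γ (A ::ₘ Δ) (n + 1)
  | lc {Γ Δ : Multiset (Fml σ)} {n : ℕ} (A : Fml σ) :
      Prf σ P (A ::ₘ A ::ₘ Γ) Δ n → Prf σ P (A ::ₘ Γ) Δ (n + 1)
  | rc {Γ Δ : Multiset (Fml σ)} {n : ℕ} (A : Fml σ) :
      Prf σ P Γ (A ::ₘ A ::ₘ Δ) n → Prf σ P Γ (A ::ₘ Δ) (n + 1)
  | lneg {Γ Δ : Multiset (Fml σ)} {n : ℕ} (A : Fml σ) :
      Prf σ P Γ (A ::ₘ Δ) n → Prf σ P (A.neg ::ₘ Γ) Δ (n + 1)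
  | rneg {Γ Δ : Multiset (Fml σ)} {n : ℕ} (A : Fml σ) :
      Prf σ P (A ::ₘ Γ) Δ n → Prf σ P Γ (A.neg ::ₘ Δ) (n + 1)
  | land {Γ Δ : Multiset (Fml σ)} {n : ℕ} (A B : Fml σ) :
      Prf σ P (A ::ₘ B ::ₘ Γ) Δ n → Prf σ P ((A.conj B) ::ₘ Γ) Δ (n + 1)
  | rand {Γ Δ : Multiset (Fml σ)} {m n : ℕ} (A B : Fml σ) :
      Prf σ P Γ (A ::ₘ Δ) m → Prf σ P Γ (B ::ₘ Δ) n →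
      Prf σ P Γ ((A.conj B) ::ₘ Δ) (max m n + 1)
  | lor {Γ Δ : Multiset (Fml σ)} {m n : ℕ} (A B : Fml σ) :
      Prf σ P (A ::ₘ Γ) Δ m → Prf σ P (B ::ₘ Γ) Δ n →
      Prf σ P ((A.disj B) ::ₘ Γ) Δ (max m n + 1)
  | ror {Γ Δ : Multiset (Fml σ)} {n : ℕ} (A B : Fml σ) :
      Prf σ P Γ (A ::ₘ B ::ₘ Δ) n → Prf σ P Γ ((A.disj B) ::ₘ Δ) (n + 1)
  | limp {Γ Δ : Multiset (Fml σ)} {m n : ℕ} (A B : Fml σ) :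
      Prf σ P Γ (A ::ₘ Δ) m → Prf σ P (B ::ₘ Γ) Δ n →
      Prf σ P ((A.imp B) ::ₘ Γ) Δ (max m n + 1)
  | rimp {Γ Δ : Multiset (Fml σ)} {n : ℕ} (A B : Fml σ) :
      Prf σ P (A ::ₘ Γ) (B ::ₘ Δ) n → Prf σ P Γ ((A.imp B) ::ₘ Δ) (n + 1)
  | lall {Γ Δ : Multiset (Fml σ)} {n : ℕ} (A : Fml σ) (t : Tm σ) :
      Prf σ P ((A.inst0 t) ::ₘ Γ) Δ n →
      Prf σ P ((Fml.ext t) ::ₘ (Fml.all A) ::ₘ Γ) Δ (n + 1)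
  | rall {Γ Δ : Multiset (Fml σ)} {n : ℕ} (A : Fml σ) (a : ℕ) :
      FreshM a Γ → FreshM a Δ → a ∉ A.pars →
      Prf σ P ((Fml.ext (.par a)) ::ₘ Γ) ((A.inst0 (.par a)) ::ₘ Δ) n →
      Prf σ P Γ ((Fml.all A) ::ₘ Δ) (n + 1)
  | lex {Γ Δ : Multiset (Fml σ)} {n : ℕ} (A : Fml σ) (a : ℕ) :
      FreshM a Γ → FreshM a Δ → a ∉ A.pars →
      Prf σ P ((Fml.ext (.par a)) ::ₘ (A.inst0 (.par a)) ::ₘ Γ) Δ n →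
      Prf σ P ((Fml.ex A) ::ₘ Γ) Δ (n + 1)
  | rex {Γ Δ : Multiset (Fml σ)} {n : ℕ} (A : Fml σ) (t : Tm σ) :
      Prf σ P Γ ((A.inst0 t) ::ₘ Δ) n →
      Prf σ P ((Fml.ext t) ::ₘ Γ) ((Fml.ex A) ::ₘ Δ) (n + 1)
  | eqI {Γ Δ : Multiset (Fml σ)} {n : ℕ} (A : Fml σ) (t₁ t₂ : Tm σ) :
      A.Atomic →
      Prf σ P ((A.inst0 t₂) ::ₘ Γ) Δ n →
      Prf σ P ((Fml.eq t₁ t₂) ::ₘ (A.inst0 t₁) ::ₘ Γ) Δ (n + 1)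
  | eqE {Γ Δ : Multiset (Fml σ)} {n : ℕ} (t : Tm σ) :
      Prf σ P ((Fml.eq t t) ::ₘ Γ) Δ n → Prf σ P Γ Δ (n + 1)
  | ri {Γ Δ : Multiset (Fml σ)} {n₁ n₂ n₃ n₄ : ℕ} (F G : Fml σ) (t : Tm σ) (a : ℕ) :
      FreshM a Γ → FreshM a Δ → a ∉ F.pars → a ∉ G.pars →
      Prf σ P Γ ((F.inst0 t) ::ₘ Δ) n₁ →
      Prf σ P Γ ((G.inst0 t) ::ₘ Δ) n₂ →
      Prf σ P Γ ((Fml.ext t) ::ₘ Δ) n₃ →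
      Prf σ P ((Fml.ext (.par a)) ::ₘ (F.inst0 (.par a)) ::ₘ Γ)
        ((Fml.eq (.par a) t) ::ₘ Δ) n₄ →
      Prf σ P Γ ((Fml.iq F G) ::ₘ Δ) (max (max n₁ n₂) (max n₃ n₄) + 1)
  | li1 {Γ Δ : Multiset (Fml σ)} {n₁ n₂ n₃ n₄ : ℕ} (F G : Fml σ) (t : Tm σ) (a b : ℕ) :
      FreshM a Γ → FreshM a Δ → a ∉ F.pars → a ∉ G.pars →
      FreshM b Γ → FreshM b Δ → b ∉ F.pars → b ∉ G.pars →
      Prf σ P Γ ((F.inst0 t) ::ₘ Δ) n₁ →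
      Prf σ P Γ ((Fml.ext t) ::ₘ Δ) n₂ →
      Prf σ P ((F.inst0 (.par a)) ::ₘ (Fml.ext (.par a)) ::ₘ Γ)
        ((Fml.eq (.par a) t) ::ₘ Δ) n₃ →
      Prf σ P ((F.inst0 (.par b)) ::ₘ (G.inst0 (.par b)) ::ₘ (Fml.ext (.par b)) ::ₘ Γ) Δ n₄ →
      Prf σ P ((Fml.iq F G) ::ₘ Γ) Δ (max (max n₁ n₂) (max n₃ n₄) + 1)
  | li2 {Γ Δ : Multiset (Fml σ)} {n₁ n₂ n₃ n₄ n₅ : ℕ} (F A : Fml σ) (t₁ t₂ : Tm σ) :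
      A.Atomic →
      Prf σ P Γ ((F.inst0 t₁) ::ₘ Δ) n₁ →
      Prf σ P Γ ((F.inst0 t₂) ::ₘ Δ) n₂ →
      Prf σ P Γ ((Fml.ext t₁) ::ₘ Δ) n₃ →
      Prf σ P Γ ((Fml.ext t₂) ::ₘ Δ) n₄ →
      Prf σ P Γ ((A.inst0 t₂) ::ₘ Δ) n₅ →
      Prf σ P ((Fml.iq F Fml.exG) ::ₘ Γ) ((A.inst0 t₁) ::ₘ Δ)
        (max (max (max n₁ n₂) (max n₃ n₄)) n₅ + 1)
  | li3 {Γ Δ : Multiset (Fml σ)} {n : ℕ} (F : Fml σ) (a : ℕ) :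
      FreshM a Γ → FreshM a Δ → a ∉ F.pars →
      Prf σ P ((F.inst0 (.par a)) ::ₘ (Fml.ext (.par a)) ::ₘ Γ) Δ n →
      Prf σ P ((Fml.iq F Fml.exG) ::ₘ Γ) Δ (n + 1)
  | li4 {Γ Δ : Multiset (Fml σ)} {n₁ n₂ n₃ n₄ : ℕ} (F A : Fml σ) (t₁ t₂ : Tm σ) :
      A.Atomic →
      Prf σ P Γ ((F.inst0 t₁) ::ₘ Δ) n₁ →
      Prf σ P Γ ((Fml.ext t₁) ::ₘ Δ) n₂ →
      Prf σ P Γ ((Fml.ext t₂) ::ₘ Δ) n₃ →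
      Prf σ P Γ ((A.inst0 t₂) ::ₘ Δ) n₄ →
      Prf σ P ((Fml.iq F (Fml.eq (.bvar 0) (t₂.lift 0))) ::ₘ Γ) ((A.inst0 t₁) ::ₘ Δ)
        (max (max n₁ n₂) (max n₃ n₄) + 1)
  | li5 {Γ Δ : Multiset (Fml σ)} {m n : ℕ} (F : Fml σ) (t : Tm σ) (a : ℕ) :
      FreshM a Γ → FreshM a Δ → a ∉ F.pars → a ∉ t.pars →
      Prf σ P Γ ((Fml.ext t) ::ₘ Δ) m →
      Prf σ P ((F.inst0 (.par a)) ::ₘ (Fml.ext (.par a)) ::ₘ Γ) Δ n →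
      Prf σ P ((Fml.iq F (Fml.eq (.bvar 0) (t.lift 0))) ::ₘ Γ) Δ (max m n + 1)

/-- Provability in GPFL=^I (cuts unrestricted). -/
def Prov (σ : Sig) (Γ Δ : Multiset (Fml σ)) : Prop :=
  ∃ n, Nonempty (Prf σ (fun _ => True) Γ Δ n)

/-- The Russellian formula `∃y(∀x(F ↔ x = y) ∧ G[y/x])`, for formulas `F`,
`G` whose variable `x` is the de Bruijn index 0.  The variable `y` is the
one bound by the outer existential quantifier, so it does not occur in `F`
or `G`. -/
def SI1L {σ : Sig} (F G : Fml σ) : Fml σ :=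
  Fml.ex (Fml.conj
    (Fml.all (Fml.iff (F.lift 1) (Fml.eq (.bvar 0) (.bvar 1)))) G)

namespace Tm

variable {σ : Sig}

theorem inst_lift (c : ℕ) (u t : Tm σ) : inst c u (t.lift c) = t := by
  induction t with
  | par a => rfl
  | const k => rfl
  | bvar n => by_cases h : n < c <;> grind [lift, inst]
  | func f ts ih => simp only [lift, inst, ih]

theorem pars_lift (c : ℕ) (t : Tm σ) : (t.lift c).pars = t.pars := by
  induction t with
  | par a => rfl
  | const k => rfl
  | bvar n => by_cases h : n < c <;> simp [lift, pars, h]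
  | func f ts ih => simp only [lift, pars, ih]

theorem pars_inst_subset (k : ℕ) (u t : Tm σ) : (inst k u t).pars ⊆ t.pars ∪ u.pars := by
  induction t with
  | par a => exact Set.subset_union_left
  | const c => exact Set.subset_union_left
  | bvar n => simp only [inst]; split_ifs <;> simp [pars]
  | func f ts ih =>
    exact Set.iUnion_subset fun i => (ih i).trans
      (Set.union_subset_union_left _ (Set.subset_iUnion (fun i => (ts i).pars) i))

theorem finite_pars (t : Tm σ) : t.pars.Finite := by
  induction t with
  | par a => exact Set.finite_singleton a
  | const k => exact Set.finite_empty
  | bvar n => exact Set.finite_empty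
  | func f ts ih => exact Set.finite_iUnion ih

end Tm

namespace Fml

variable {σ : Sig}

theorem inst_lift (c : ℕ) (u : Tm σ) (A : Fml σ) : (A.lift c).inst c u = A := by
  induction A generalizing c u <;> simp_all [lift, inst, Tm.inst_lift]

theorem pars_lift (c : ℕ) (A : Fml σ) : (A.lift c).pars = A.pars := by
  induction A generalizing c <;> simp_all [lift, pars, Tm.pars_lift]

theorem finite_pars (A : Fml σ) : A.pars.Finite := by
  induction A with
  | atom p ts => exact Set.finite_iUnion fun i => (ts i).finite_pars
  | eq t s => exact t.finite_pars.union s.finite_pars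
  | ext t => exact t.finite_pars
  | neg A ih => exact ih
  | conj A B ihA ihB => exact ihA.union ihB
  | disj A B ihA ihB => exact ihA.union ihB
  | imp A B ihA ihB => exact ihA.union ihB
  | all A ih => exact ih
  | ex A ih => exact ih
  | iq F G ihF ihG => exact ihF.union ihG

theorem pars_inst_subset (k : ℕ) (u : Tm σ) (A : Fml σ) :
    (A.inst k u).pars ⊆ A.pars ∪ u.pars := by
  induction A generalizing k u with
  | atom p ts =>
    exact Set.iUnion_subset fun i => (Tm.pars_inst_subset k u (ts i)).trans
      (Set.union_subset_union_left _ (Set.subset_iUnion (fun i => (ts i).pars) i))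
  | eq t s =>
    have ht := Tm.pars_inst_subset k u t
    have hs := Tm.pars_inst_subset k u s
    simp only [inst, pars]
    grind
  | ext t => exact Tm.pars_inst_subset k u t
  | neg A ih => exact ih k u
  | conj A B ihA ihB | disj A B ihA ihB | imp A B ihA ihB =>
    have hA := ihA k u
    have hB := ihB k u
    simp only [inst, pars]
    grind
  | all A ih | ex A ih => simpa only [inst, pars, Tm.pars_lift] using ih (k + 1) (u.lift 0)
  | iq F G ihF ihG =>
    have hF := ihF (k + 1) (u.lift 0)
    have hG := ihG (k + 1) (u.lift 0)
    rw [Tm.pars_lift] at hF hG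
    simp only [inst, pars]
    grind

theorem inst0_iff_eq (F : Fml σ) (t : Tm σ) (b : ℕ) :
    (iff F (eq (.bvar 0) (.par b))).inst0 t = iff (F.inst0 t) (eq t (.par b)) := by
  simp [iff, inst0, inst, Tm.inst]

theorem inst0_russell (F G : Fml σ) (b : ℕ) :
    (conj (all (iff (F.lift 1) (eq (.bvar 0) (.bvar 1)))) G).inst0 (.par b) =
      conj (all (iff F (eq (.bvar 0) (.par b)))) (G.inst0 (.par b)) := by
  simp [iff, inst0, inst, Tm.inst, Tm.lift, inst_lift]

end Fml

namespace Prov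

variable {σ : Sig} {Γ Δ : Multiset (Fml σ)}

theorem weaken_left (Γ' : Multiset (Fml σ)) (h : Prov σ Γ Δ) : Prov σ (Γ' + Γ) Δ := by
  induction Γ' using Multiset.induction_on with
  | empty => simpa using h
  | cons A Γ' ih =>
    obtain ⟨n, ⟨d⟩⟩ := ih
    rw [Multiset.cons_add]
    exact ⟨_, ⟨.lw A d⟩⟩

theorem weaken_right (Δ' : Multiset (Fml σ)) (h : Prov σ Γ Δ) : Prov σ Γ (Δ' + Δ) := by
  induction Δ' using Multiset.induction_on with
  | empty => simpa using h
  | cons A Δ' ih =>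
    obtain ⟨n, ⟨d⟩⟩ := ih
    rw [Multiset.cons_add]
    exact ⟨_, ⟨.rw A d⟩⟩

theorem of_mem {A : Fml σ} (hΓ : A ∈ Γ) (hΔ : A ∈ Δ) : Prov σ Γ Δ := by
  obtain ⟨Γ', rfl⟩ := Multiset.exists_cons_of_mem hΓ
  obtain ⟨Δ', rfl⟩ := Multiset.exists_cons_of_mem hΔ
  have h : Prov σ {A} {A} := ⟨1, ⟨.ax A⟩⟩
  simpa only [add_comm _ {A}, Multiset.singleton_add] using (h.weaken_left Γ').weaken_right Δ'

theorem eq_refl {t : Tm σ} (h : Fml.eq t t ∈ Δ) : Prov σ Γ Δ := by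
  obtain ⟨n, ⟨d⟩⟩ := of_mem (Γ := Fml.eq t t ::ₘ Γ) (Multiset.mem_cons_self _ _) h
  exact ⟨_, ⟨.eqE t d⟩⟩

theorem contract_left {A : Fml σ} (h : Prov σ (A ::ₘ Γ) Δ) (hA : A ∈ Γ) : Prov σ Γ Δ := by
  obtain ⟨Γ', rfl⟩ := Multiset.exists_cons_of_mem hA
  obtain ⟨n, ⟨d⟩⟩ := h
  exact ⟨_, ⟨.lc A d⟩⟩

theorem imp_left {A B : Fml σ} (h₁ : Prov σ Γ (A ::ₘ Δ)) (h₂ : Prov σ (B ::ₘ Γ) Δ) :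
    Prov σ (A.imp B ::ₘ Γ) Δ := by
  obtain ⟨m, ⟨d₁⟩⟩ := h₁
  obtain ⟨n, ⟨d₂⟩⟩ := h₂
  exact ⟨_, ⟨.limp A B d₁ d₂⟩⟩

theorem conj_left {A B : Fml σ} (h : Prov σ (A ::ₘ B ::ₘ Γ) Δ) : Prov σ (A.conj B ::ₘ Γ) Δ := by
  obtain ⟨n, ⟨d⟩⟩ := h
  exact ⟨_, ⟨.land A B d⟩⟩

theorem all_left {A : Fml σ} {t : Tm σ} (h : Prov σ (A.inst0 t ::ₘ Γ) Δ)
    (ht : Fml.ext t ∈ Γ) (hA : Fml.all A ∈ Γ) : Prov σ Γ Δ := by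
  obtain ⟨n, ⟨d⟩⟩ := h
  have h' : Prov σ (Fml.ext t ::ₘ Fml.all A ::ₘ Γ) Δ := ⟨_, ⟨.lall A t d⟩⟩
  exact (h'.contract_left (Multiset.mem_cons_of_mem ht)).contract_left hA

end Prov

/-- **Theorem 1(a), second direction.**  For all formulas `F`, `G`, the
sequent (SI1): `∃y(∀x(F ↔ x = y) ∧ G[y/x]) ⇒ Ix[F,G]` is provable in
GPFL=^I. -/
theorem si1_provable {σ : Sig} (F G : Fml σ) :
    Prov σ {SI1L F G} {Fml.iq F G} := by
  obtain ⟨b, hb⟩ := (F.finite_pars.union G.finite_pars).exists_notMem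
  obtain ⟨a, ha⟩ := ((F.finite_pars.union G.finite_pars).insert b).exists_notMem
  simp only [Set.mem_insert_iff, Set.mem_union, not_or] at ha hb
  obtain ⟨hab, haF, haG⟩ := ha
  obtain ⟨hbF, hbG⟩ := hb
  set H : Fml σ := .all (.iff F (.eq (.bvar 0) (.par b))) with hH
  set Γ : Multiset (Fml σ) := {.ext (.par b), H, G.inst0 (.par b)} with hΓ
  have h_inst_F : Prov σ Γ {F.inst0 (.par b)} := by
    refine .all_left (t := .par b) (A := .iff F (.eq (.bvar 0) (.par b))) ?_
      (by simp [hΓ]) (by simp [hΓ, hH])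
    rw [Fml.inst0_iff_eq]
    refine .conj_left ?_
    rw [Multiset.cons_swap]
    exact .imp_left (.eq_refl (t := .par b) (by simp))
      (.of_mem (A := F.inst0 (.par b)) (by simp) (by simp))
  have h_unique : Prov σ (.ext (.par a) ::ₘ F.inst0 (.par a) ::ₘ Γ) {.eq (.par a) (.par b)} := by
    refine .all_left (t := .par a) (A := .iff F (.eq (.bvar 0) (.par b))) ?_
      (by simp) (by simp [hΓ, hH])
    rw [Fml.inst0_iff_eq]
    exact .conj_left (.imp_left (.of_mem (A := F.inst0 (.par a)) (by simp) (by simp))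
      (.of_mem (A := .eq (.par a) (.par b)) (by simp) (by simp)))
  have h_inst_G : Prov σ Γ {G.inst0 (.par b)} :=
    .of_mem (A := G.inst0 (.par b)) (by simp [hΓ]) (by simp)
  have h_ext : Prov σ Γ {.ext (.par b)} :=
    .of_mem (A := .ext (.par b)) (by simp [hΓ]) (by simp)
  have h_fresh : FreshM a Γ := by
    have hGb : a ∉ (G.inst0 (.par b)).pars := fun h =>
      (G.pars_inst_subset 0 (.par b) h).elim haG hab
    simp [FreshM, hΓ, hH, Fml.pars, Fml.iff, Tm.pars, haF, hab, hGb]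
  obtain ⟨n₁, ⟨d₁⟩⟩ := h_inst_F
  obtain ⟨n₂, ⟨d₂⟩⟩ := h_inst_G
  obtain ⟨n₃, ⟨d₃⟩⟩ := h_ext
  obtain ⟨n₄, ⟨d₄⟩⟩ := h_unique
  have h_iq : Prov σ Γ {Fml.iq F G} :=
    ⟨_, ⟨.ri F G (.par b) a h_fresh (by simp [FreshM]) haF haG d₁ d₂ d₃ d₄⟩⟩
  have h_matrix : Prov σ (.ext (.par b) ::ₘ (H.conj (G.inst0 (.par b))) ::ₘ 0) {Fml.iq F G} := by
    rw [Multiset.cons_swap]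
    refine .conj_left ?_
    convert h_iq using 1
    simp only [hΓ, Multiset.insert_eq_cons, ← Multiset.cons_zero]
    rw [Multiset.cons_swap (G.inst0 _), Multiset.cons_swap H]
  rw [hH, ← Fml.inst0_russell] at h_matrix
  obtain ⟨n, ⟨d⟩⟩ := h_matrix
  refine ⟨_, ⟨.lex _ b (by simp [FreshM]) ?_ ?_ d⟩⟩
  · simp [FreshM, Fml.pars, hbF, hbG]
  · simp [Fml.pars, Fml.iff, Tm.pars, Fml.pars_lift, hbF, hbG]
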